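/- There exists an absolute constant C > 0 such that for all ξ, η ∈ ℝ with (ξ,η) ≠ (0,0), all 0 ≤ s ≤ t ≤ 1 and all ε₁, ε₂, λ ∈ [0,1]: |γ_{s,t}(ξ,|η|)| ≤ C ( |t−s|^{ε₁} |ξ|^{ε₁} / (η⁴ + ξ²)^{λ/2} + |t−s|^{ε₂} / (η⁴ + ξ²)^{(1−ε₂)/2} ). (Here (η⁴+ξ²)^{1/2} is the complex modulus |η² + iξ|.) -/

import Mathlib

open MeasureTheory

/-- `γ_t(ξ, r) = e^{iξt} ∫_0^t e^{-u(r² + iξ)} du`. -/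
noncomputable def gam (t ξ r : ℝ) : ℂ :=
  Complex.exp (Complex.I * (ξ * t)) *
    ∫ u in (0:ℝ)..t, Complex.exp (-(u : ℂ) * ((r : ℂ) ^ 2 + Complex.I * (ξ : ℂ)))

/-- `γ_{s,t}(ξ, r) = γ_t(ξ, r) - γ_s(ξ, r)`. -/
noncomputable def gamst (s t ξ r : ℝ) : ℂ := gam t ξ r - gam s ξ r

theorem min_one_le_rpow {x e : ℝ} (hx : 0 ≤ x) (he : e ∈ Set.Icc (0:ℝ) 1) :
    min 1 x ≤ x ^ e := by
  rcases le_total 1 x with h | h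
  · exact (min_le_left _ _).trans (Real.one_le_rpow h he.1)
  · exact (min_le_right _ _).trans (Real.self_le_rpow_of_le_one hx h he.2)

theorem gam_eq {ξ r : ℝ} (h : (r : ℂ) ^ 2 + Complex.I * ξ ≠ 0) (t : ℝ) :
    gam t ξ r = (Complex.exp (Complex.I * (ξ * t)) - Real.exp (-(t * r ^ 2)))
      / ((r : ℂ) ^ 2 + Complex.I * ξ) := by
  have hint : (∫ u in (0:ℝ)..t, Complex.exp (-(u : ℂ) * ((r : ℂ) ^ 2 + Complex.I * (ξ : ℂ))))
      = ∫ u in (0:ℝ)..t, Complex.exp (-((r : ℂ) ^ 2 + Complex.I * (ξ : ℂ)) * u) := by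
    congr 1; ext u; congr 1; ring
  rw [gam, hint, integral_exp_mul_complex (neg_ne_zero.mpr h), div_neg, ← neg_div, mul_div_assoc']
  congr 1
  have hexp : Complex.exp (Complex.I * (ξ * t))
      * Complex.exp (-((r : ℂ) ^ 2 + Complex.I * ξ) * t) = Real.exp (-(t * r ^ 2)) := by
    rw [← Complex.exp_add, Complex.ofReal_exp]
    congr 1; push_cast; ring
  rw [← hexp]
  simp
  ring

theorem norm_exp_I_mul_sub_le (a b : ℝ) :
    ‖Complex.exp (Complex.I * a) - Complex.exp (Complex.I * b)‖ ≤ 2 * min 1 |a - b| := by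
  have h : Complex.exp (Complex.I * a) - Complex.exp (Complex.I * b)
      = Complex.exp (Complex.I * b) * (Complex.exp (Complex.I * (a - b : ℝ)) - 1) := by
    rw [mul_sub, ← Complex.exp_add, mul_one]
    congr 2; push_cast; ring
  have hb : ‖Complex.exp (Complex.I * b)‖ = 1 := Complex.norm_exp_I_mul_ofReal b
  have h1 := Real.norm_exp_I_mul_ofReal_sub_one_le (x := a - b)
  have h2 := norm_sub_le (Complex.exp (Complex.I * (a - b : ℝ))) 1
  rw [Complex.norm_exp_I_mul_ofReal, norm_one] at h2
  rw [Real.norm_eq_abs] at h1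
  rw [h, norm_mul, hb, one_mul, mul_min_of_nonneg _ _ zero_le_two]
  exact le_min (by linarith) (by linarith [abs_nonneg (a - b)])

theorem abs_exp_neg_sub_le {a b : ℝ} (ha : 0 ≤ a) (hab : a ≤ b) :
    |Real.exp (-b) - Real.exp (-a)| ≤ min 1 (b - a) := by
  have h1 : Real.exp (-b) ≤ Real.exp (-a) := Real.exp_le_exp.mpr (by linarith)
  have h2 : Real.exp (-a) ≤ 1 := Real.exp_le_one_iff.mpr (by linarith)
  have h3 : Real.exp (-b) = Real.exp (-a) * Real.exp (-(b - a)) := by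
    rw [← Real.exp_add]; congr 1; ring
  have h4 := Real.add_one_le_exp (-(b - a))
  rw [abs_sub_comm, abs_of_nonneg (by linarith)]
  refine le_min (by linarith [Real.exp_pos (-b)]) ?_
  rw [h3]
  nlinarith [Real.exp_pos (-a)]

/-- There is an absolute constant `C > 0` such that for all `(ξ, η) ≠ (0,0)`,
all `0 ≤ s ≤ t ≤ 1` and all `ε₁, ε₂, λ ∈ [0,1]`:
`|γ_{s,t}(ξ,|η|)| ≤ C (|t−s|^{ε₁} |ξ|^{ε₁} / (η⁴+ξ²)^{λ/2} + |t−s|^{ε₂} / (η⁴+ξ²)^{(1−ε₂)/2})`. -/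
theorem stmt6 :
    ∃ C : ℝ, 0 < C ∧ ∀ ξ η s t ε₁ ε₂ lam : ℝ, ¬(ξ = 0 ∧ η = 0) →
      0 ≤ s → s ≤ t → t ≤ 1 →
      ε₁ ∈ Set.Icc (0:ℝ) 1 → ε₂ ∈ Set.Icc (0:ℝ) 1 → lam ∈ Set.Icc (0:ℝ) 1 →
      ‖gamst s t ξ |η|‖ ≤
        C * (|t - s| ^ ε₁ * |ξ| ^ ε₁ / (η ^ 4 + ξ ^ 2) ^ (lam / 2)
          + |t - s| ^ ε₂ / (η ^ 4 + ξ ^ 2) ^ ((1 - ε₂) / 2)) := by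
  refine ⟨3, by norm_num, ?_⟩
  intro ξ η s t ε₁ ε₂ lam h0 hs hst ht h₁ h₂ hl
  set Z : ℝ := Real.sqrt (η ^ 4 + ξ ^ 2) with hZ
  have hpos : 0 < η ^ 4 + ξ ^ 2 := by
    by_cases hξ : ξ = 0
    · have : η ≠ 0 := fun h => h0 ⟨hξ, h⟩
      positivity
    · positivity
  have hZpos : 0 < Z := Real.sqrt_pos.mpr hpos
  have hZsq : Z ^ 2 = η ^ 4 + ξ ^ 2 := Real.sq_sqrt hpos.le
  have hpow : ∀ a : ℝ, (η ^ 4 + ξ ^ 2) ^ (a / 2) = Z ^ a := fun a => by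
    rw [hZ, Real.sqrt_eq_rpow, ← Real.rpow_mul hpos.le]; congr 1; ring
  have hnorm : ‖((|η| : ℝ) : ℂ) ^ 2 + Complex.I * ξ‖ = Z := by
    have h : ((|η| : ℝ) : ℂ) ^ 2 + Complex.I * ξ = ((η ^ 2 : ℝ) : ℂ) + (ξ : ℝ) * Complex.I := by
      rw [← Complex.ofReal_pow, sq_abs]; ring
    rw [h, Complex.norm_add_mul_I, hZ]
    congr 1; ring
  have hne : ((|η| : ℝ) : ℂ) ^ 2 + Complex.I * ξ ≠ 0 := by
    rw [← norm_pos_iff, hnorm]; exact hZpos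
  have hξZ : |ξ| ≤ Z := Real.le_sqrt_of_sq_le (by rw [sq_abs]; nlinarith [sq_nonneg (η ^ 2)])
  have hηZ : η ^ 2 ≤ Z := Real.le_sqrt_of_sq_le (by nlinarith [sq_nonneg ξ])
  have hd : 0 ≤ t - s := by linarith
  have hd1 : t - s ≤ 1 := by linarith
  rw [hpow, hpow, abs_of_nonneg hd]
  have hA : ‖Complex.exp (Complex.I * (ξ * t)) - Complex.exp (Complex.I * (ξ * s))‖
      ≤ 2 * min 1 ((t - s) * |ξ|) := by
    have h := norm_exp_I_mul_sub_le (ξ * t) (ξ * s)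
    rwa [← mul_sub, abs_mul, abs_of_nonneg hd, mul_comm |ξ|, Complex.ofReal_mul,
      Complex.ofReal_mul] at h
  have hB : |Real.exp (-(t * |η| ^ 2)) - Real.exp (-(s * |η| ^ 2))|
      ≤ min 1 ((t - s) * η ^ 2) := by
    rw [sq_abs, sub_mul]
    exact abs_exp_neg_sub_le (by positivity) (by gcongr)
  have hdecomp : gamst s t ξ |η| = ((Complex.exp (Complex.I * (ξ * t))
        - Complex.exp (Complex.I * (ξ * s)))
      - ((Real.exp (-(t * |η| ^ 2)) - Real.exp (-(s * |η| ^ 2)) : ℝ) : ℂ))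
      / (((|η| : ℝ) : ℂ) ^ 2 + Complex.I * ξ) := by
    rw [gamst, gam_eq hne, gam_eq hne, ← sub_div]
    congr 1; push_cast; ring
  have hbound : ‖gamst s t ξ |η|‖
      ≤ 2 * (min 1 ((t - s) * |ξ|) / Z) + min 1 ((t - s) * η ^ 2) / Z := by
    rw [hdecomp, norm_div, hnorm, mul_div_assoc', ← add_div]
    refine div_le_div_of_nonneg_right ((norm_sub_le _ _).trans (add_le_add hA ?_)) hZpos.le
    rwa [Complex.norm_real, Real.norm_eq_abs]
  have hparabolic : min 1 ((t - s) * η ^ 2) / Z ≤ (t - s) ^ ε₂ / Z ^ (1 - ε₂) := by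
    rw [Real.rpow_sub hZpos, Real.rpow_one, div_div_eq_mul_div,
      ← Real.mul_rpow hd hZpos.le]
    refine div_le_div_of_nonneg_right ((min_one_le_rpow (by positivity) h₂).trans ?_) hZpos.le
    exact Real.rpow_le_rpow (by positivity) (by gcongr) h₂.1
  have hX : 0 ≤ (t - s) ^ ε₁ * |ξ| ^ ε₁ / Z ^ lam := by positivity
  have hY : 0 ≤ (t - s) ^ ε₂ / Z ^ (1 - ε₂) := by positivity
  rcases le_total 1 Z with h | h
  · have hosc : min 1 ((t - s) * |ξ|) / Z ≤ (t - s) ^ ε₁ * |ξ| ^ ε₁ / Z ^ lam := by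
      rw [← Real.mul_rpow hd (abs_nonneg _)]
      refine div_le_div₀ (by positivity) (min_one_le_rpow (by positivity) h₁) (by positivity) ?_
      simpa using Real.rpow_le_rpow_of_exponent_le h hl.2
    linarith
  · have hosc : min 1 ((t - s) * |ξ|) / Z ≤ t - s := by
      rw [div_le_iff₀ hZpos]
      exact (min_le_right _ _).trans (by gcongr)
    have hlow : t - s ≤ (t - s) ^ ε₂ / Z ^ (1 - ε₂) := by
      rw [le_div_iff₀ (by positivity)]
      refine (mul_le_of_le_one_right hd ?_).trans (Real.self_le_rpow_of_le_one hd hd1 h₂.2)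
      exact Real.rpow_le_one hZpos.le h (by linarith [h₂.2])
    linarith
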